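/- Let k > 3 and let d = k² − 4. If k is even, then the fundamental solution of the Pell equation x² − d·y² = 1 is (x₁, y₁) = ((k² − 2)/2, k/2). If k is odd, then the fundamental solution of x² − d·y² = 1 is (x₁, y₁) = ((k³ − 3k)/2, (k² − 1)/2). -/

import Mathlib

/-- `(x₁, y₁)` is the fundamental solution of `x² - d·y² = N`: it is a positive integer
solution, and every other positive integer solution `(x, y)` satisfies `x₁ < x` and `y₁ < y`. -/
def IsFundamentalSolution (d N x₁ y₁ : ℤ) : Prop :=
  0 < x₁ ∧ 0 < y₁ ∧ x₁ ^ 2 - d * y₁ ^ 2 = N ∧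
    ∀ x y : ℤ, 0 < x → 0 < y → x ^ 2 - d * y ^ 2 = N → (x, y) ≠ (x₁, y₁) → x₁ < x ∧ y₁ < y

lemma aux_gap (k W Z : ℤ) (hk : 3 < k) (hZ : 0 < Z)
    (h : W ^ 2 - (k ^ 2 - 4) * Z ^ 2 = 4) : Z = 1 ∨ k ≤ Z := by
  by_cases h1 : Z = 1
  · exact Or.inl h1
  right
  have hZ2 : 2 ≤ Z := by omega
  have hkZ : 0 < k * Z := by positivity
  have hlt : W < k * Z := by
    apply lt_of_pow_lt_pow_left₀ 2 hkZ.le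
    nlinarith
  have hev : Even (k * Z - W) := by
    have h3 : Even ((k * Z) ^ 2 - W ^ 2) := ⟨2 * Z ^ 2 - 2, by linarith [mul_pow k Z 2]⟩
    rw [Int.even_sub, Int.even_pow' two_ne_zero, Int.even_pow' two_ne_zero] at h3
    rwa [Int.even_sub]
  obtain ⟨r, hr⟩ := hev
  have hr1 : 1 ≤ r := by omega
  have hgt : -(k * Z) < W := by
    have : |W| < |k * Z| := by
      apply sq_lt_sq.mp
      nlinarith
    rw [abs_of_pos hkZ] at this
    exact (abs_lt.mp this).1
  have hle : W ≤ k * Z - 2 := by omega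
  have hge : -(k * Z - 2) ≤ W := by omega
  have hsq : W ^ 2 ≤ (k * Z - 2) ^ 2 := sq_le_sq' hge hle
  have : k * Z ≤ Z * Z := by nlinarith
  exact le_of_mul_le_mul_right this hZ

lemma aux_fund (d x₁ y₁ : ℤ) (hd : 0 < d) (hx : 0 < x₁) (hy : 0 < y₁)
    (h : x₁ ^ 2 - d * y₁ ^ 2 = 1)
    (hmin : ∀ x y : ℤ, 0 < x → 0 < y → x ^ 2 - d * y ^ 2 = 1 → y₁ ≤ y) :
    IsFundamentalSolution d 1 x₁ y₁ := by
  refine ⟨hx, hy, h, fun x y hx' hy' h' hne => ?_⟩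
  rcases (hmin x y hx' hy' h').lt_or_eq with hlt | heq
  · refine ⟨?_, hlt⟩
    apply lt_of_pow_lt_pow_left₀ 2 hx'.le
    have h2 : y₁ ^ 2 < y ^ 2 := pow_lt_pow_left₀ hlt hy.le two_ne_zero
    nlinarith
  · exfalso
    apply hne
    subst heq
    have : x ^ 2 = x₁ ^ 2 := by linarith
    rw [(pow_left_inj₀ hx'.le hx.le two_ne_zero).mp this]

theorem fundamental_solution_one_k_sq_sub_four (k : ℤ) (hk : 3 < k) :
    (Even k → ∀ x₁ y₁ : ℤ, 2 * x₁ = k ^ 2 - 2 → 2 * y₁ = k →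
      IsFundamentalSolution (k ^ 2 - 4) 1 x₁ y₁) ∧
    (Odd k → ∀ x₁ y₁ : ℤ, 2 * x₁ = k ^ 3 - 3 * k → 2 * y₁ = k ^ 2 - 1 →
      IsFundamentalSolution (k ^ 2 - 4) 1 x₁ y₁) := by
  have hd : 0 < k ^ 2 - 4 := by nlinarith
  constructor
  · intro _ x₁ y₁ h1 h2
    refine aux_fund _ _ _ hd (by nlinarith) (by linarith) ?_ ?_
    · have : (2 * x₁) ^ 2 - (k ^ 2 - 4) * (2 * y₁) ^ 2 = 4 := by rw [h1, h2]; ring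
      linarith
    · intro x y hx hy h
      rcases aux_gap k (2 * x) (2 * y) hk (by linarith) (by linarith) with h | h <;> omega
  · intro hodd x₁ y₁ h1 h2
    refine aux_fund _ _ _ hd ?_ (by nlinarith) ?_ ?_
    · have : 0 < k * (k ^ 2 - 3) := mul_pos (by linarith) (by linarith)
      linarith
    · have : (2 * x₁) ^ 2 - (k ^ 2 - 4) * (2 * y₁) ^ 2 = 4 := by rw [h1, h2]; ring
      linarith
    · intro x y hx hy h
      have hZ : 0 < k * y - x := by
        have : x < k * y := by
          apply lt_of_pow_lt_pow_left₀ 2 (by positivity)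
          nlinarith
        linarith
      have hW : 0 < k * x - (k ^ 2 - 4) * y := by
        have : (k ^ 2 - 4) * y < k * x := by
          apply lt_of_pow_lt_pow_left₀ 2 (by positivity)
          have e : (k * x) ^ 2 - ((k ^ 2 - 4) * y) ^ 2
              = k ^ 2 * (x ^ 2 - (k ^ 2 - 4) * y ^ 2) + 4 * ((k ^ 2 - 4) * y ^ 2) := by ring
          rw [h] at e
          have : 0 < (k ^ 2 - 4) * y ^ 2 := by positivity
          nlinarith
        linarith
      have hN : (k * x - (k ^ 2 - 4) * y) ^ 2 - (k ^ 2 - 4) * (k * y - x) ^ 2 = 4 := by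
        linear_combination 4 * h
      have hy4 : 4 * y = k * (k * y - x) + (k * x - (k ^ 2 - 4) * y) := by ring
      rcases aux_gap k _ _ hk hZ hN with hz | hz
      · exfalso
        rw [hz] at hN hy4
        have hWk : (k * x - (k ^ 2 - 4) * y) ^ 2 = k ^ 2 := by linarith
        have := (pow_left_inj₀ hW.le (by linarith) two_ne_zero).mp hWk
        obtain ⟨m, hm⟩ := hodd
        omega
      · have hzz : k ^ 2 ≤ (k * y - x) ^ 2 := pow_le_pow_left₀ (by linarith) hz 2
        have hW2 : k ^ 2 - 2 ≤ k * x - (k ^ 2 - 4) * y := by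
          apply (fun hh => (pow_le_pow_iff_left₀ (by linarith) hW.le two_ne_zero).mp hh : (k ^ 2 - 2) ^ 2 ≤ (k * x - (k ^ 2 - 4) * y) ^ 2 → _)
          nlinarith
        have : k * k ≤ k * (k * y - x) := mul_le_mul_of_nonneg_left hz (by linarith)
        nlinarith
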